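/- Let A and B be two elements of SU(2) that do not commute and are both of infinite order. Then the subgroup of SU(2) generated by A and B is dense in SU(2). -/

import Mathlib

/-- `SU(2)`: the subgroup of the unitary group of `2 × 2` complex matrices consisting of
matrices with determinant `1`, with its standard (subspace) topology. -/
def SU2 : Subgroup (Matrix.unitaryGroup (Fin 2) ℂ) where
  carrier := {U | (U : Matrix (Fin 2) (Fin 2) ℂ).det = 1}
  one_mem' := by simp
  mul_mem' := by
    intro a b ha hb
    simp only [Set.mem_setOf_eq, Matrix.UnitaryGroup.mul_val, Matrix.det_mul] at *
    rw [ha, hb, one_mul]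
  inv_mem' := by
    intro a ha
    simp only [Set.mem_setOf_eq, Matrix.UnitaryGroup.inv_val] at *
    rw [Matrix.star_eq_conjTranspose, Matrix.det_conjTranspose, ha, star_one]

namespace SU2Proof
open Complex

/-- The two coordinates of an element of SU(2). -/
def ca (g : SU2) : ℂ := (g : Matrix.unitaryGroup (Fin 2) ℂ).1 0 0
def cb (g : SU2) : ℂ := (g : Matrix.unitaryGroup (Fin 2) ℂ).1 0 1

lemma inv_mat (g : SU2) : (g⁻¹ : SU2).1.1 = star g.1.1 := rfl

lemma star_mat (g : SU2) : star g.1.1 = g.1.1.adjugate := by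
  have h1 : g.1.1 * star g.1.1 = 1 := Matrix.mem_unitaryGroup_iff.mp g.1.2
  have h2 : g.1.1.adjugate * g.1.1 = 1 := by
    rw [Matrix.adjugate_mul, show g.1.1.det = 1 from g.2, one_smul]
  calc star g.1.1 = (g.1.1.adjugate * g.1.1) * star g.1.1 := by rw [h2, one_mul]
    _ = _ := by rw [mul_assoc, h1, mul_one]

lemma e11 (g : SU2) : g.1.1 1 1 = star (ca g) := by
  have := congrFun (congrFun (star_mat g) 0) 0
  rw [Matrix.adjugate_fin_two] at this
  simpa [Matrix.star_apply, ca] using this.symm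

lemma e10 (g : SU2) : g.1.1 1 0 = - star (cb g) := by
  have := congrFun (congrFun (star_mat g) 1) 0
  rw [Matrix.adjugate_fin_two] at this
  have h : star (cb g) = - g.1.1 1 0 := by simpa [Matrix.star_apply, cb] using this
  rw [h, neg_neg]

lemma ext' {g h : SU2} (ha : ca g = ca h) (hb : cb g = cb h) : g = h := by
  apply Subtype.ext
  apply Subtype.ext
  ext i j
  fin_cases i <;> fin_cases j
  · exact ha
  · exact hb
  · change g.1.1 1 0 = h.1.1 1 0
    rw [e10, e10, hb]
  · change g.1.1 1 1 = h.1.1 1 1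
    rw [e11, e11, ha]

lemma ca_mul (g h : SU2) : ca (g * h) = ca g * ca h - cb g * star (cb h) := by
  change (g.1.1 * h.1.1) 0 0 = _
  rw [Matrix.mul_apply, Fin.sum_univ_two, e10]
  simp only [ca, cb]; ring

lemma cb_mul (g h : SU2) : cb (g * h) = ca g * cb h + cb g * star (ca h) := by
  change (g.1.1 * h.1.1) 0 1 = _
  rw [Matrix.mul_apply, Fin.sum_univ_two, e11]
  simp only [ca, cb]

lemma ca_inv (g : SU2) : ca g⁻¹ = star (ca g) := by
  change (star g.1.1) 0 0 = _
  simp [Matrix.star_apply, ca]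

lemma cb_inv (g : SU2) : cb g⁻¹ = - cb g := by
  change (star g.1.1) 0 1 = _
  rw [Matrix.star_apply, e10]; simp

lemma ca_one : ca 1 = 1 := rfl
lemma cb_one : cb 1 = 0 := rfl

lemma norm_eq (g : SU2) : normSq (ca g) + normSq (cb g) = 1 := by
  have h := congrArg ca (mul_inv_cancel g)
  rw [ca_mul, ca_inv, cb_inv, ca_one] at h
  have h2 : ((normSq (ca g) + normSq (cb g) : ℝ) : ℂ) = 1 := by
    push_cast
    rw [normSq_eq_conj_mul_self, normSq_eq_conj_mul_self]
    simp only [star_neg, RCLike.star_def] at h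
    linear_combination h
  exact_mod_cast h2

/-- Build an element from its coordinates. -/
def mk (a b : ℂ) (h : normSq a + normSq b = 1) : SU2 :=
  ⟨⟨!![a, b; -star b, star a], by
    have h' : star a * a + star b * b = 1 := by
      have : ((normSq a + normSq b : ℝ) : ℂ) = 1 := by rw [h]; simp
      push_cast at this
      rw [normSq_eq_conj_mul_self, normSq_eq_conj_mul_self] at this
      exact this
    rw [Matrix.mem_unitaryGroup_iff]
    ext i j
    fin_cases i <;> fin_cases j <;>
      simp [Matrix.mul_apply, Matrix.star_apply, Fin.sum_univ_two] <;>
      simp only [RCLike.star_def] at h' <;> first | linear_combination h' | ring⟩, by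
    have : ((normSq a + normSq b : ℝ) : ℂ) = 1 := by rw [h]; simp
    push_cast at this
    rw [normSq_eq_conj_mul_self, normSq_eq_conj_mul_self] at this
    change Matrix.det !![a, b; -star b, star a] = 1
    rw [Matrix.det_fin_two_of]
    simp only [RCLike.star_def]
    linear_combination this⟩

@[simp] lemma ca_mk (a b : ℂ) (h) : ca (mk a b h) = a := rfl
@[simp] lemma cb_mk (a b : ℂ) (h) : cb (mk a b h) = b := rfl

/-- diagonal torus -/
noncomputable def D (t : ℝ) : SU2 := mk (exp (t * I)) 0 (by
  rw [normSq_eq_norm_sq, norm_exp_ofReal_mul_I]; simp)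

/-- rotations -/
noncomputable def R (t : ℝ) : SU2 := mk (Real.cos t : ℝ) (Real.sin t : ℝ) (by
  rw [normSq_ofReal, normSq_ofReal]
  nlinarith [Real.sin_sq_add_cos_sq t])

@[simp] lemma ca_D (t : ℝ) : ca (D t) = exp (t * I) := rfl
@[simp] lemma cb_D (t : ℝ) : cb (D t) = 0 := rfl

lemma star_exp (t : ℝ) : star (exp (t * I)) = exp (-(t * I)) := by
  rw [RCLike.star_def, ← exp_conj]; simp

lemma D_add (s t : ℝ) : D (s + t) = D s * D t := by
  apply ext'
  · rw [ca_mul]; simp [add_mul, exp_add]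
  · rw [cb_mul]; simp

lemma R_add (s t : ℝ) : R (s + t) = R s * R t := by
  apply ext'
  · rw [ca_mul]; simp [R, ← ofReal_cos, ← ofReal_sin, -ofReal_cos, -ofReal_sin, Real.cos_add]
  · rw [cb_mul]
    simp [R, ← ofReal_cos, ← ofReal_sin, -ofReal_cos, -ofReal_sin, Real.sin_add]; ring

lemma D_zero : D 0 = 1 := by
  apply ext' <;> simp [ca_one, cb_one]

lemma D_neg (t : ℝ) : D (-t) = (D t)⁻¹ := by
  rw [eq_inv_iff_mul_eq_one, ← D_add, neg_add_cancel, D_zero]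

lemma R_zero : R 0 = 1 := by
  apply ext' <;> simp [ca_one, cb_one, R]

lemma R_nsmul (n : ℕ) (t : ℝ) : R (n * t) = R t ^ n := by
  induction n with
  | zero => simp [R_zero]
  | succ k ih => rw [pow_succ, ← ih, ← R_add]; push_cast; ring_nf

lemma D_nsmul (n : ℕ) (t : ℝ) : D (n * t) = D t ^ n := by
  induction n with
  | zero => simp [D_zero]
  | succ k ih => rw [pow_succ, ← ih, ← D_add]; push_cast; ring_nf

lemma D_two_pi_int (m : ℤ) : D (m * (2 * Real.pi)) = 1 := by
  apply ext'
  · rw [ca_one, ca_D, exp_eq_one_iff]; exact ⟨m, by push_cast; ring⟩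
  · simp [cb_one]

lemma D_cont : Continuous D := by
  unfold D mk
  apply Continuous.subtype_mk
  apply Continuous.subtype_mk
  apply continuous_matrix
  intro i j
  fin_cases i <;> fin_cases j <;> simp <;> fun_prop

lemma exists_diag (g : SU2) : ∃ (P : SU2) (t : ℝ), g = P * D t * P⁻¹ := by
  by_cases hb : cb g = 0
  · have hn := norm_eq g
    rw [hb, map_zero, add_zero, normSq_eq_norm_sq] at hn
    have hn' : ‖ca g‖ = 1 := by
      nlinarith [norm_nonneg (ca g)]
    refine ⟨1, arg (ca g), ?_⟩
    simp only [one_mul, inv_one, mul_one]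
    apply ext'
    · have := norm_mul_exp_arg_mul_I (ca g)
      rw [hn'] at this
      simpa using this.symm
    · simpa using hb
  · set x := (ca g).re with hx
    set y := (ca g).im with hy
    have hn := norm_eq g
    have hbpos : 0 < normSq (cb g) := normSq_pos.mpr hb
    rw [normSq_apply] at hn
    have hx1 : -1 ≤ x := by nlinarith
    have hx2 : x ≤ 1 := by nlinarith
    set t := Real.arccos x with ht
    have hc : Real.cos t = x := Real.cos_arccos hx1 hx2
    set s := Real.sin t with hs
    have hsc : s ^ 2 + x ^ 2 = 1 := by rw [← hc]; exact Real.sin_sq_add_cos_sq t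
    set n := Real.sqrt (normSq (cb g) + (s - y) ^ 2) with hnn
    have hpos : 0 < normSq (cb g) + (s - y) ^ 2 := by positivity
    have hn2 : n ^ 2 = normSq (cb g) + (s - y) ^ 2 := Real.sq_sqrt hpos.le
    have hnp : 0 < n := Real.sqrt_pos.mpr hpos
    have hnC : (n : ℂ) ≠ 0 := by exact_mod_cast hnp.ne'
    have hga : ca g = x + y * I := (re_add_im _).symm
    have hex : exp (t * I) = x + s * I := by
      rw [exp_mul_I, ← ofReal_cos, ← ofReal_sin, hc]
    have hex' : star (exp (t * I)) = x - s * I := by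
      rw [hex]; simp; ring
    have hbb : star (cb g) * cb g = ((s ^ 2 - y ^ 2 : ℝ) : ℂ) := by
      rw [RCLike.star_def, ← normSq_eq_conj_mul_self]
      congr 1
      nlinarith
    refine ⟨mk (cb g / n) (((s - y) / n : ℝ) * I) ?_, t, ?_⟩
    · rw [map_div₀, map_mul, normSq_ofReal, normSq_ofReal, normSq_I]
      field_simp
      linarith
    · rw [eq_mul_inv_iff_mul_eq]
      apply ext'
      · rw [ca_mul, ca_mul]
        simp only [ca_mk, cb_mk, ca_D, cb_D, hex, hga]
        simp
        field_simp
        ring_nf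
        try simp only [I_sq]
        try ring
      · rw [cb_mul, cb_mul]
        simp only [ca_mk, cb_mk, ca_D, cb_D, hex', hga]
        have : star (cb g / n) = star (cb g) / n := by simp
        rw [this]
        push_cast at hbb ⊢
        field_simp
        linear_combination hbb + ((s : ℂ) ^ 2 - y ^ 2) * I_sq

lemma exists_phase {z w : ℂ} (h : normSq z = normSq w) : ∃ φ : ℝ, z = exp (φ * I) * w := by
  have h' : ‖z‖ = ‖w‖ := by
    rw [normSq_eq_norm_sq, normSq_eq_norm_sq] at h
    exact (pow_left_inj₀ (norm_nonneg _) (norm_nonneg _) two_ne_zero).mp h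
  refine ⟨arg z - arg w, ?_⟩
  calc z = ‖w‖ * exp (arg z * I) := by rw [← h']; exact (norm_mul_exp_arg_mul_I z).symm
    _ = exp ((arg z - arg w : ℝ) * I) * (‖w‖ * exp (arg w * I)) := by
      rw [mul_left_comm, ← exp_add]; push_cast; ring_nf
    _ = _ := by rw [norm_mul_exp_arg_mul_I w]

lemma double_coset {g h : SU2} (H : normSq (ca g) = normSq (ca h)) :
    ∃ s t, g = D s * h * D t := by
  obtain ⟨φ, hφ⟩ := exists_phase H
  have H2 : normSq (cb g) = normSq (cb h) := by linarith [norm_eq g, norm_eq h]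
  obtain ⟨ψ, hψ⟩ := exists_phase H2
  refine ⟨(φ + ψ) / 2, (φ - ψ) / 2, ?_⟩
  apply ext'
  · simp only [ca_mul, cb_mul, ca_D, cb_D, hφ]
    simp only [star_zero, mul_zero, sub_zero, zero_mul]
    rw [mul_right_comm, ← exp_add]
    push_cast; ring_nf
  · simp only [ca_mul, cb_mul, ca_D, cb_D, hψ, star_exp]
    simp only [mul_zero, zero_mul, zero_add, add_zero]
    rw [mul_right_comm, ← exp_add]
    push_cast; ring_nf

lemma cb_conj (Q : SU2) (t : ℝ) (h : ca Q * cb Q = 0) : cb (Q * D t * Q⁻¹) = 0 := by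
  simp only [ca_mul, cb_mul, ca_D, cb_D, ca_inv, cb_inv, star_star]
  simp only [mul_zero, star_zero, sub_zero, zero_add]
  linear_combination (star (exp (t * I)) - exp (t * I)) * h

lemma ca_conj (Q : SU2) (t : ℝ) : normSq (ca (Q * D t * Q⁻¹)) =
    1 - 4 * normSq (ca Q) * normSq (cb Q) * Real.sin t ^ 2 := by
  have h1 : ca (Q * D t * Q⁻¹) = ((Real.cos t : ℝ) : ℂ)
      + (((normSq (ca Q) - normSq (cb Q)) * Real.sin t : ℝ) : ℂ) * I := by
    simp only [ca_mul, cb_mul, ca_D, cb_D, ca_inv, cb_inv, star_exp, star_neg]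
    have h2 : ((normSq (ca Q) + normSq (cb Q) : ℝ) : ℂ) = 1 := by rw [norm_eq]; simp
    rw [← neg_mul, exp_mul_I, exp_mul_I, cos_neg, sin_neg]
    push_cast at h2 ⊢
    rw [normSq_eq_conj_mul_self, normSq_eq_conj_mul_self] at *
    simp only [RCLike.star_def, map_zero]
    linear_combination cos t * h2
  rw [h1, normSq_add_mul_I]
  have h3 := norm_eq Q
  have h4 := Real.sin_sq_add_cos_sq t
  have h5 : normSq (cb Q) = 1 - normSq (ca Q) := by linarith
  rw [h5]
  linear_combination h4

lemma core (K : Subgroup SU2) (hD : ∀ t, D t ∈ K) (Q : SU2) (hQ : ∀ t, Q * D t * Q⁻¹ ∈ K)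
    (hne : ca Q * cb Q ≠ 0) (g : SU2) : g ∈ K := by
  have hdc : ∀ {g h : SU2}, h ∈ K → normSq (ca g) = normSq (ca h) → g ∈ K := by
    intro g h hh H
    obtain ⟨s, t, rfl⟩ := double_coset H
    exact K.mul_mem (K.mul_mem (hD _) hh) (hD _)
  have hp := normSq_pos.mpr (left_ne_zero_of_mul hne)
  have hq := normSq_pos.mpr (right_ne_zero_of_mul hne)
  set c := 4 * normSq (ca Q) * normSq (cb Q) with hc
  have hcpos : 0 < c := by positivity
  set r := Real.sqrt c with hr
  have hrpos : 0 < r := Real.sqrt_pos.mpr hcpos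
  have hr2 : r ^ 2 = c := Real.sq_sqrt hcpos.le
  have hR : ∀ θ : ℝ, 0 ≤ θ → θ ≤ r → R θ ∈ K := by
    intro θ h0 h1
    have habs : |Real.sin θ / r| ≤ 1 := by
      rw [abs_div, abs_of_pos hrpos, div_le_one hrpos]
      have := Real.abs_sin_le_abs (x := θ)
      rw [abs_of_nonneg h0] at this
      exact this.trans h1
    have hs : Real.sin (Real.arcsin (Real.sin θ / r)) = Real.sin θ / r :=
      Real.sin_arcsin (abs_le.mp habs).1 (abs_le.mp habs).2
    apply hdc (hQ (Real.arcsin (Real.sin θ / r)))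
    rw [ca_conj, hs, ← hc, div_pow, hr2, mul_div_cancel₀ _ hcpos.ne']
    change normSq ((Real.cos θ : ℝ) : ℂ) = _
    rw [normSq_ofReal]
    nlinarith [Real.sin_sq_add_cos_sq θ]
  have hle : ‖ca g‖ ≤ 1 := by
    have := norm_eq g
    rw [normSq_eq_norm_sq, normSq_eq_norm_sq] at this
    nlinarith [norm_nonneg (ca g), sq_nonneg ‖cb g‖]
  set θ := Real.arccos ‖ca g‖ with hθ
  have hθ0 : 0 ≤ θ := Real.arccos_nonneg _
  obtain ⟨n, hn⟩ := exists_nat_gt (θ / r)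
  have hn0 : (0 : ℝ) < n := lt_of_le_of_lt (by positivity) hn
  have hRθ : R θ ∈ K := by
    have : R θ = R (θ / n) ^ n := by
      rw [← R_nsmul, mul_div_cancel₀ _ hn0.ne']
    rw [this]
    apply K.pow_mem
    apply hR _ (by positivity)
    rw [div_lt_iff₀ hrpos] at hn
    rw [div_le_iff₀ hn0]
    linarith
  apply hdc hRθ
  change _ = normSq ((Real.cos θ : ℝ) : ℂ)
  rw [normSq_ofReal, Real.cos_arccos (by linarith [norm_nonneg (ca g)]) hle, normSq_eq_norm_sq]
  ring

lemma torus (H : Subgroup SU2) (hH : IsClosed (H : Set SU2)) (P : SU2) (t₀ : ℝ)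
    (hmem : P * D t₀ * P⁻¹ ∈ H) (hinf : ¬ IsOfFinOrder (P * D t₀ * P⁻¹)) (t : ℝ) :
    P * D t * P⁻¹ ∈ H := by
  let G : AddSubgroup ℝ :=
    { carrier := {t | P * D t * P⁻¹ ∈ H}
      zero_mem' := by simp [D_zero]
      add_mem' := by
        intro a b ha hb
        have := H.mul_mem ha hb
        simp only [Set.mem_setOf_eq, D_add]
        convert this using 1
        group
      neg_mem' := by
        intro a ha
        have := H.inv_mem ha
        simp only [Set.mem_setOf_eq, D_neg]
        convert this using 1
        group }
  have hG : IsClosed (G : Set ℝ) := by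
    apply hH.preimage (f := fun t => P * D t * P⁻¹)
    have := D_cont
    fun_prop
  have ht0 : t₀ ∈ G := hmem
  have hpi : 2 * Real.pi ∈ G := by
    change P * D (2 * Real.pi) * P⁻¹ ∈ H
    have := D_two_pi_int 1
    simp only [Int.cast_one, one_mul] at this
    simp [this]
  rcases AddSubgroup.dense_or_cyclic G with h | ⟨a, ha⟩
  · have : (G : Set ℝ) = Set.univ := by rw [← hG.closure_eq]; exact h.closure_eq
    have ht : t ∈ (G : Set ℝ) := by rw [this]; trivial
    exact ht
  · exfalso
    rw [ha, AddSubgroup.mem_closure_singleton] at ht0 hpi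
    obtain ⟨m, hm⟩ := ht0
    obtain ⟨n, hn⟩ := hpi
    rw [zsmul_eq_mul] at hm hn
    have hn0 : n ≠ 0 := by
      rintro rfl
      simp at hn
    apply hinf
    have hz : D (((n.natAbs : ℕ) : ℝ) * t₀) = 1 := by
      have hh : ((n.natAbs : ℕ) : ℝ) = |(n : ℝ)| := by
        rw [Nat.cast_natAbs]; simp
      rcases abs_choice (n : ℝ) with h | h
      · rw [hh, h, ← hm, ← D_two_pi_int m, ← hn]; congr 1; ring
      · rw [hh, h, ← hm, ← D_two_pi_int (-m), ← hn]; congr 1; push_cast; ring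
    rw [isOfFinOrder_iff_pow_eq_one]
    refine ⟨n.natAbs, Int.natAbs_pos.mpr hn0, ?_⟩
    rw [conj_pow, ← D_nsmul, hz]
    simp

end SU2Proof

open SU2Proof in
theorem su2_two_noncommuting_infinite_order_dense
    (A B : SU2) (hcomm : A * B ≠ B * A)
    (hA : ¬ IsOfFinOrder A) (hB : ¬ IsOfFinOrder B) :
    Dense ((Subgroup.closure {A, B} : Subgroup SU2) : Set SU2) := by
  set H := (Subgroup.closure {A, B} : Subgroup SU2).topologicalClosure with hHdef
  have hcl : IsClosed (H : Set SU2) := Subgroup.isClosed_topologicalClosure _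
  have hsub : (Subgroup.closure {A, B} : Subgroup SU2) ≤ H := Subgroup.le_topologicalClosure _
  have hAH : A ∈ H := hsub (Subgroup.subset_closure (by simp))
  have hBH : B ∈ H := hsub (Subgroup.subset_closure (by simp))
  obtain ⟨P, s, rfl⟩ := exists_diag A
  obtain ⟨P', t, rfl⟩ := exists_diag B
  have h1 := torus H hcl P s hAH hA
  have h2 := torus H hcl P' t hBH hB
  have hne : ca (P⁻¹ * P') * cb (P⁻¹ * P') ≠ 0 := by
    intro h0
    apply hcomm
    have hb := cb_conj (P⁻¹ * P') t h0
    have hc : D s * ((P⁻¹ * P') * D t * (P⁻¹ * P')⁻¹)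
        = ((P⁻¹ * P') * D t * (P⁻¹ * P')⁻¹) * D s := by
      generalize (P⁻¹ * P') * D t * (P⁻¹ * P')⁻¹ = X at hb
      apply ext'
      · rw [ca_mul, ca_mul, hb, cb_D]; ring
      · rw [cb_mul, cb_mul, hb, cb_D]; ring
    calc _ = P * (D s * ((P⁻¹ * P') * D t * (P⁻¹ * P')⁻¹)) * P⁻¹ := by group
      _ = _ := by rw [hc]; group
  intro g
  change g ∈ H
  have key := core (H.comap (MulAut.conj P).toMonoidHom) (fun u => by
      simpa [Subgroup.mem_comap] using h1 u) (P⁻¹ * P') (fun u => by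
      have := h2 u
      rw [Subgroup.mem_comap]
      convert this using 1
      simp only [MulEquiv.toMonoidHom_eq_coe, MonoidHom.coe_coe, MulAut.conj_apply]
      group) hne (P⁻¹ * g * P)
  rw [Subgroup.mem_comap] at key
  convert key using 1
  simp only [MulEquiv.toMonoidHom_eq_coe, MonoidHom.coe_coe, MulAut.conj_apply]
  group
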